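/- Conservativity over Boolean semantics: if the labelling function is {0,1}-valued (i.e., L(λ_i)(p) ∈ {0,1} for all states λ_i and atoms p), then for every LTLf formula φ and index i, the quantitative evaluation [[φ, i]](λ) lies in {0,1}, and [[φ, i]](λ) = 1 if and only if the trace satisfies φ at position i under the standard Boolean LTLf semantics. -/

import Mathlib

namespace QLTLf

/-- Syntax of LTLf[F] formulas over a set `P` of atoms. -/
inductive Formula (P : Type) where
  | tru  : Formula P
  | atom : P → Formula P
  | neg  : Formula P → Formula P
  | conj : Formula P → Formula P → Formula P
  | next : Formula P → Formula P
  | untl : Formula P → Formula P → Formula P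
  | rels : Formula P → Formula P → Formula P

/-- Maximum of a list of reals, with the empty maximum equal to 0. -/
def sup0 (l : List ℝ) : ℝ := l.foldr max 0

/-- Minimum of a list of reals, with the empty minimum equal to 1. -/
def inf1 (l : List ℝ) : ℝ := l.foldr min 1

/-- The list of indices j with i ≤ j ≤ n. -/
def idxTo (i n : ℕ) : List ℕ := List.range' i (n + 1 - i)

/-- The list of indices k with i ≤ k < j. -/
def idxLt (i j : ℕ) : List ℕ := List.range' i (j - i)

/-- Quantitative LTLf semantics `[[φ, i]](λ)` on a finite trace of length `n`
with labelling `L` (position `i`, atom `p` ↦ `L i p`). -/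
def eval {P : Type} (L : ℕ → P → ℝ) (n : ℕ) : Formula P → ℕ → ℝ
  | .tru, _ => 1
  | .atom p, i => L i p
  | .neg φ, i => 1 - eval L n φ i
  | .conj φ ψ, i => min (eval L n φ i) (eval L n ψ i)
  | .next φ, i => if i < n then eval L n φ (i + 1) else 0
  | .untl φ ψ, i => sup0 ((idxTo i n).map fun j =>
      min (eval L n ψ j) (inf1 ((idxLt i j).map fun k => eval L n φ k)))
  | .rels φ ψ, i => inf1 ((idxTo i n).map fun j =>
      max (eval L n ψ j) (sup0 ((idxLt i j).map fun k => eval L n φ k)))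

/-- Falsum, `⊥ := ¬⊤`. -/
def fls {P : Type} : Formula P := .neg .tru

/-- Disjunction, derived; its evaluation is the fuzzy max. -/
def disj {P : Type} (φ ψ : Formula P) : Formula P := .neg (.conj (.neg φ) (.neg ψ))

/-- Eventually, `F φ := ⊤ U φ`. -/
def Fev {P : Type} (φ : Formula P) : Formula P := .untl .tru φ

/-- Always, `G φ := ⊥ R φ`. -/
def Gal {P : Type} (φ : Formula P) : Formula P := .rels fls φ

end QLTLf

open QLTLf in
/-- Standard Boolean LTLf satisfaction on a finite trace of length `n`. -/
def QLTLf.Sat {P : Type} (L : ℕ → P → ℝ) (n : ℕ) : QLTLf.Formula P → ℕ → Prop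
  | .tru, _ => True
  | .atom p, i => L i p = 1
  | .neg φ, i => ¬ QLTLf.Sat L n φ i
  | .conj φ ψ, i => QLTLf.Sat L n φ i ∧ QLTLf.Sat L n ψ i
  | .next φ, i => i < n ∧ QLTLf.Sat L n φ (i + 1)
  | .untl φ ψ, i => ∃ j, i ≤ j ∧ j ≤ n ∧ QLTLf.Sat L n ψ j ∧
      ∀ k, i ≤ k → k < j → QLTLf.Sat L n φ k
  | .rels φ ψ, i => ∀ j, i ≤ j → j ≤ n → QLTLf.Sat L n ψ j ∨
      ∃ k, i ≤ k ∧ k < j ∧ QLTLf.Sat L n φ k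

namespace QLTLf

/-- The real number `x` is the characteristic value, `0` or `1`, of the proposition `p`. -/
def IsTruthValue (x : ℝ) (p : Prop) : Prop := (x = 0 ∨ x = 1) ∧ (x = 1 ↔ p)

namespace IsTruthValue

variable {x y : ℝ} {p q : Prop}

theorem zero : IsTruthValue 0 False := by simp [IsTruthValue]

theorem one : IsTruthValue 1 True := by simp [IsTruthValue]

theorem congr_prop (h : IsTruthValue x p) (hpq : p ↔ q) : IsTruthValue x q :=
  ⟨h.1, h.2.trans hpq⟩

theorem one_sub (h : IsTruthValue x p) : IsTruthValue (1 - x) (¬p) := by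
  obtain ⟨rfl | rfl, h⟩ := h <;> simp [IsTruthValue, ← h]

theorem min (hx : IsTruthValue x p) (hy : IsTruthValue y q) :
    IsTruthValue (min x y) (p ∧ q) := by
  obtain ⟨rfl | rfl, hx⟩ := hx <;> obtain ⟨rfl | rfl, hy⟩ := hy <;>
    simp [IsTruthValue, ← hx, ← hy]

theorem max (hx : IsTruthValue x p) (hy : IsTruthValue y q) :
    IsTruthValue (max x y) (p ∨ q) := by
  obtain ⟨rfl | rfl, hx⟩ := hx <;> obtain ⟨rfl | rfl, hy⟩ := hy <;>
    simp [IsTruthValue, ← hx, ← hy]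

theorem sup0_map {α : Type*} {f : α → ℝ} {r : α → Prop} (h : ∀ a, IsTruthValue (f a) (r a))
    (l : List α) : IsTruthValue (sup0 (l.map f)) (∃ a ∈ l, r a) := by
  induction l with
  | nil => simpa [sup0] using zero
  | cons a l ih => exact ((h a).max ih).congr_prop (by simp)

theorem inf1_map {α : Type*} {f : α → ℝ} {r : α → Prop} (h : ∀ a, IsTruthValue (f a) (r a))
    (l : List α) : IsTruthValue (inf1 (l.map f)) (∀ a ∈ l, r a) := by
  induction l with
  | nil => simpa [inf1] using one
  | cons a l ih => exact ((h a).min ih).congr_prop (by simp)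

end IsTruthValue

theorem mem_idxTo {i n j : ℕ} : j ∈ idxTo i n ↔ i ≤ j ∧ j ≤ n := by
  rw [idxTo, List.mem_range'_1]
  omega

theorem mem_idxLt {i j k : ℕ} : k ∈ idxLt i j ↔ i ≤ k ∧ k < j := by
  rw [idxLt, List.mem_range'_1]
  omega

theorem isTruthValue_eval {P : Type} {L : ℕ → P → ℝ} (n : ℕ)
    (hL : ∀ i p, L i p = 0 ∨ L i p = 1) (φ : Formula P) (i : ℕ) :
    IsTruthValue (eval L n φ i) (Sat L n φ i) := by
  induction φ generalizing i with
  | tru => exact .one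
  | atom p => exact ⟨hL i p, Iff.rfl⟩
  | neg φ ih => exact (ih i).one_sub
  | conj φ ψ ihφ ihψ => exact (ihφ i).min (ihψ i)
  | next φ ih =>
    rw [eval, Sat]
    split_ifs with hi
    · exact (ih (i + 1)).congr_prop (by simp [hi])
    · exact IsTruthValue.zero.congr_prop (by simp [hi])
  | untl φ ψ ihφ ihψ =>
    refine (IsTruthValue.sup0_map (fun j => (ihψ j).min (.inf1_map ihφ (idxLt i j)))
      (idxTo i n)).congr_prop ?_
    simp only [Sat, mem_idxTo, mem_idxLt, and_assoc, and_imp]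
  | rels φ ψ ihφ ihψ =>
    refine (IsTruthValue.inf1_map (fun j => (ihψ j).max (.sup0_map ihφ (idxLt i j)))
      (idxTo i n)).congr_prop ?_
    simp only [Sat, mem_idxTo, mem_idxLt, and_assoc, and_imp]

end QLTLf

open QLTLf in
/-- conservativity over Boolean semantics. -/
theorem eval_boolean_conservative (P : Type) (L : ℕ → P → ℝ) (n : ℕ)
    (hL : ∀ i p, L i p = 0 ∨ L i p = 1)
    (φ : Formula P) (i : ℕ) (hi1 : 1 ≤ i) (hin : i ≤ n) :
    (eval L n φ i = 0 ∨ eval L n φ i = 1)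
    ∧ (eval L n φ i = 1 ↔ QLTLf.Sat L n φ i) :=
  isTruthValue_eval n hL φ i
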